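/- Let V = V⁰ ⊕ c₀V^{-1} model the ghost-number-one string field, with operators Q̃ : V⁰ → V¹ (into an auxiliary space), M : V^{-1} → V¹, L₀ invertible on all spaces, satisfying Q̃² = −L₀M with all pairwise commutators zero, and M injective on V^{-1} with partial inverse W₁ (W₁M = id on V^{-1}, MW₁ = id on im M = V¹). Define the gauge transformation δ(φ, ω) = (Q̃λ + Mρ, L₀λ − Q̃ρ) for parameters (λ, ρ) ∈ V^{-1} × V^{-2}. Then: (i) for any (φ, ω) there exists a gauge transformation bringing it to satisfy Q̃φ' = 0, namely λ + c₀ρ = (1/L₀)W₁(Q̃φ); (ii) any gauge transformation preserving the condition Q̃φ = 0 acts trivially, i.e., δ(φ,ω) = 0. -/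

import Mathlib

/-- the Landau-type gauge condition `Q̃φ = 0` fixes the gauge.
Setup: graded spaces `V^n = G n` (restricted to `L₀` invertible), `Q̃` of degree 1,
`M` of degree 2, `L₀` of degree 0 with inverse `L₀⁻¹`, `Q̃² = -L₀M`, all pairwise
commuting, `W₁` the partial inverse of `M` (`W₁M = id` on `V^{-1}`, `MW₁ = id` on
`V¹ = im M`), and `M` injective on `V^{-1}` and `V^{-2}`.  The gauge transformation
is `δ(φ, ω) = (Q̃λ + Mρ, L₀λ - Q̃ρ)` for `(λ, ρ) ∈ V^{-1} × V^{-2}`.  Then: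
(i) the gauge parameter `λ = (1/L₀)W₁(Q̃φ)` (with `ρ = 0`) brings any `φ` to
satisfy `Q̃φ' = 0`;
(ii) any gauge transformation preserving the condition acts trivially. -/
theorem landau_gauge_fixing
    {W : Type*} [AddCommGroup W] [Module ℚ W]
    (Qt M L0 L0inv W1 : Module.End ℚ W) (G : ℤ → Submodule ℚ W)
    (hQtG : ∀ n : ℤ, ∀ v ∈ G n, Qt v ∈ G (n + 1))
    (hMG : ∀ n : ℤ, ∀ v ∈ G n, M v ∈ G (n + 2))
    (hL0G : ∀ n : ℤ, ∀ v ∈ G n, L0 v ∈ G n)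
    (hL0invG : ∀ n : ℤ, ∀ v ∈ G n, L0inv v ∈ G n)
    (hW1G : ∀ v ∈ G 1, W1 v ∈ G (-1))
    (hQt2 : Qt * Qt = -(L0 * M))
    (hQM : Qt * M = M * Qt) (hQL : Qt * L0 = L0 * Qt) (hLM : L0 * M = M * L0)
    (hL0i : L0 * L0inv = 1) (hL0i' : L0inv * L0 = 1)
    (hL0iQ : L0inv * Qt = Qt * L0inv) (hL0iM : L0inv * M = M * L0inv)
    (hW1M : ∀ v ∈ G (-1), W1 (M v) = v)
    (hMW1 : ∀ w ∈ G 1, M (W1 w) = w)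
    (hMinj : ∀ v : W, (v ∈ G (-1) ∨ v ∈ G (-2)) → M v = 0 → v = 0) :
    (∀ φ ∈ G 0, Qt (φ + Qt (L0inv (W1 (Qt φ)))) = 0) ∧
    (∀ lam ∈ G (-1), ∀ rho ∈ G (-2),
      Qt (Qt lam + M rho) = 0 → Qt lam + M rho = 0 ∧ L0 lam - Qt rho = 0) := by
  have e2 : ∀ v, Qt (Qt v) = -(L0 (M v)) := fun v => LinearMap.congr_fun hQt2 v
  have eQM : ∀ v, Qt (M v) = M (Qt v) := fun v => LinearMap.congr_fun hQM v
  have eQL : ∀ v, Qt (L0 v) = L0 (Qt v) := fun v => LinearMap.congr_fun hQL v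
  have eLM : ∀ v, L0 (M v) = M (L0 v) := fun v => LinearMap.congr_fun hLM v
  have eLi : ∀ v, L0 (L0inv v) = v := fun v => LinearMap.congr_fun hL0i v
  have eLi' : ∀ v, L0inv (L0 v) = v := fun v => LinearMap.congr_fun hL0i' v
  refine ⟨fun φ hφ => ?_, fun lam hl rho hr h => ?_⟩
  · have h1 : Qt φ ∈ G 1 := by simpa using hQtG 0 φ hφ
    rw [map_add, e2, eLM, eLi, hMW1 _ h1, add_neg_cancel]
  · have hmem : L0 lam - Qt rho ∈ G (-1) :=
      (G (-1)).sub_mem (hL0G _ _ hl) (by simpa using hQtG (-2) rho hr)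
    have hz : L0 lam - Qt rho = 0 := by
      apply hMinj _ (Or.inl hmem)
      rw [map_add, e2, eQM, eLM] at h
      rw [map_sub, ← neg_eq_zero, ← h]
      abel
    refine ⟨?_, hz⟩
    have h3 : L0 (Qt lam + M rho) = 0 := by
      have h4 := congrArg Qt hz
      rw [map_sub, map_zero, eQL, e2, sub_neg_eq_add] at h4
      rw [map_add, h4]
    rw [← eLi' (Qt lam + M rho), h3, map_zero]
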